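/- arXiv:2504.03236 — 3 statements merged into one kernel-verified Lean document; each statement's English description precedes it below -/
import Mathlib

section
/- Let H and K be complex Hilbert spaces, let A : K → H be a bounded operator with ‖A‖ ≤ 1, let Z₊ : H → H be a bounded invertible operator, and let Z₋ : H → K be a bounded operator. Assume there exists c > 0 such that ‖Z₊ x‖² − ‖Z₋ x‖² ≥ c ‖x‖² for all x ∈ H. Then ‖A ∘ Z₋ ∘ Z₊⁻¹‖ < 1 and the operator Z₊ − A ∘ Z₋ : H → H is invertible (it has a bounded inverse). -/
noncomputable section

/-- If `‖A‖ ≤ 1`, `Z₊` is invertible and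
`‖Z₊ x‖² − ‖Z₋ x‖² ≥ c ‖x‖²` with `c > 0`, then `‖A ∘ Z₋ ∘ Z₊⁻¹‖ < 1` and `Z₊ − A ∘ Z₋` is
invertible. -/
theorem statement5 {H K : Type}
    [NormedAddCommGroup H] [InnerProductSpace ℂ H] [CompleteSpace H]
    [NormedAddCommGroup K] [InnerProductSpace ℂ K] [CompleteSpace K]
    (A : K →L[ℂ] H) (hA : ‖A‖ ≤ 1)
    (Zp : H →L[ℂ] H) (hZp : IsUnit Zp)
    (Zm : H →L[ℂ] K)
    (c : ℝ) (hc : 0 < c)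
    (hbound : ∀ x : H, c * ‖x‖ ^ 2 ≤ ‖Zp x‖ ^ 2 - ‖Zm x‖ ^ 2) :
    ‖A ∘L Zm ∘L Ring.inverse Zp‖ < 1 ∧ IsUnit (Zp - A ∘L Zm) := by
  obtain ⟨u, rfl⟩ := hZp
  rw [Ring.inverse_unit]
  have hT : ‖A ∘L Zm ∘L (↑u⁻¹ : H →L[ℂ] H)‖ < 1 := by
    set N := ‖(u : H →L[ℂ] H)‖
    have hD : 0 < N ^ 2 + c := by positivity
    have hq : 0 ≤ N ^ 2 / (N ^ 2 + c) := by positivity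
    have hq1 : √(N ^ 2 / (N ^ 2 + c)) < 1 := by
      rw [Real.sqrt_lt' one_pos, one_pow, div_lt_one hD]
      linarith
    refine (ContinuousLinearMap.opNorm_le_bound _ (Real.sqrt_nonneg _) fun y ↦ ?_).trans_lt hq1
    set x := (↑u⁻¹ : H →L[ℂ] H) y with hx
    have hux : (u : H →L[ℂ] H) x = y := by
      rw [hx, ← mul_apply_eq_comp, Units.mul_inv, one_apply_eq_self]
    have hyx : ‖y‖ ^ 2 ≤ N ^ 2 * ‖x‖ ^ 2 := by
      rw [← mul_pow, ← hux]
      gcongr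
      exact ContinuousLinearMap.le_opNorm _ _
    have hb := hbound x
    rw [hux] at hb
    have hZ : ‖Zm x‖ ≤ √(N ^ 2 / (N ^ 2 + c)) * ‖y‖ := by
      refine abs_le_of_sq_le_sq' ?_ (by positivity) |>.2
      rw [mul_pow, Real.sq_sqrt hq, div_mul_eq_mul_div, le_div_iff₀ hD]
      nlinarith [mul_le_mul_of_nonneg_left hb (sq_nonneg N),
        mul_le_mul_of_nonneg_left hyx hc.le,
        mul_le_mul_of_nonneg_left hb hc.le, mul_nonneg (mul_nonneg hc.le hc.le) (sq_nonneg ‖x‖)]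
    exact (A.le_of_opNorm_le hA (Zm x)).trans (by rwa [one_mul])
  refine ⟨hT, ?_⟩
  have hfactor : (u : H →L[ℂ] H) - A ∘L Zm =
      (1 - A ∘L Zm ∘L (↑u⁻¹ : H →L[ℂ] H)) * u := by
    have h : (A ∘L Zm) * (↑u⁻¹ : H →L[ℂ] H) * u = A ∘L Zm := Units.inv_mul_cancel_right _ u
    rw [sub_mul, one_mul]
    exact congrArg _ h.symm
  rw [hfactor]
  exact (isUnit_one_sub_of_norm_lt_one hT).mul u.isUnit

end
end

section
/- Let H, K, U, Y be complex Hilbert spaces and let A : K → H, B : U → H, C : K → Y, D : U → Y be bounded operators such that the block operator K ⊕ U → H ⊕ Y, (x, u) ↦ (A x + B u, C x + D u), has operator norm at most 1 (with respect to the Hilbert direct-sum norms). Let Z₊ : H → H be a bounded invertible operator and Z₋ : H → K a bounded operator, and assume there exists c > 0 such that ‖Z₊ x‖² − ‖Z₋ x‖² ≥ c ‖x‖² for all x ∈ H. Then Z₊ − A ∘ Z₋ is invertible and ‖D + C ∘ Z₋ ∘ (Z₊ − A ∘ Z₋)⁻¹ ∘ B‖ ≤ ‖[[A, B], [C, D]]‖,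 the norm of the block operator K ⊕ U → H ⊕ Y. -/
noncomputable section

/-- The block operator `K ⊕ U → H ⊕ Y`, `(x, u) ↦ (A x + B u, C x + D u)`, with respect to
the Hilbert (`ℓ²`) direct-sum structures. -/
def blockOp {H K U Y : Type}
    [NormedAddCommGroup H] [InnerProductSpace ℂ H]
    [NormedAddCommGroup K] [InnerProductSpace ℂ K]
    [NormedAddCommGroup U] [InnerProductSpace ℂ U]
    [NormedAddCommGroup Y] [InnerProductSpace ℂ Y]
    (A : K →L[ℂ] H) (B : U →L[ℂ] H) (C : K →L[ℂ] Y) (D : U →L[ℂ] Y) :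
    WithLp 2 (K × U) →L[ℂ] WithLp 2 (H × Y) :=
  ((WithLp.prodContinuousLinearEquiv 2 ℂ H Y).symm : H × Y →L[ℂ] WithLp 2 (H × Y)) ∘L
    ((A ∘L ContinuousLinearMap.fst ℂ K U + B ∘L ContinuousLinearMap.snd ℂ K U).prod
      (C ∘L ContinuousLinearMap.fst ℂ K U + D ∘L ContinuousLinearMap.snd ℂ K U)) ∘L
    ((WithLp.prodContinuousLinearEquiv 2 ℂ K U : WithLp 2 (K × U) →L[ℂ] K × U))

/-- The defining inequality of the norm of a block operator, in terms of its entries. -/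
theorem blockOp_norm_sq_le {H K U Y : Type}
    [NormedAddCommGroup H] [InnerProductSpace ℂ H]
    [NormedAddCommGroup K] [InnerProductSpace ℂ K]
    [NormedAddCommGroup U] [InnerProductSpace ℂ U]
    [NormedAddCommGroup Y] [InnerProductSpace ℂ Y]
    (A : K →L[ℂ] H) (B : U →L[ℂ] H) (C : K →L[ℂ] Y) (D : U →L[ℂ] Y) (x : K) (u : U) :
    ‖A x + B u‖ ^ 2 + ‖C x + D u‖ ^ 2 ≤ ‖blockOp A B C D‖ ^ 2 * (‖x‖ ^ 2 + ‖u‖ ^ 2) := by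
  have h := (blockOp A B C D).le_opNorm (WithLp.toLp 2 (x, u))
  have h2 := pow_le_pow_left₀ (norm_nonneg _) h 2
  rw [mul_pow, WithLp.prod_norm_sq_eq_of_L2, WithLp.prod_norm_sq_eq_of_L2] at h2
  exact h2

/-- The norm of a block operator dominates the norm of its upper left entry. -/
theorem norm_le_norm_blockOp {H K U Y : Type}
    [NormedAddCommGroup H] [InnerProductSpace ℂ H]
    [NormedAddCommGroup K] [InnerProductSpace ℂ K]
    [NormedAddCommGroup U] [InnerProductSpace ℂ U]
    [NormedAddCommGroup Y] [InnerProductSpace ℂ Y]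
    (A : K →L[ℂ] H) (B : U →L[ℂ] H) (C : K →L[ℂ] Y) (D : U →L[ℂ] Y) :
    ‖A‖ ≤ ‖blockOp A B C D‖ := by
  refine A.opNorm_le_bound (ContinuousLinearMap.opNorm_nonneg _) fun x => ?_
  have h := blockOp_norm_sq_le A B C D x 0
  simp only [map_zero, add_zero, norm_zero] at h
  refine (sq_le_sq₀ (norm_nonneg _) (by positivity)).mp ?_
  nlinarith [sq_nonneg ‖C x‖]

/-- If `‖P x‖² − ‖M x‖² ≥ c ‖x‖²` with `c > 0` and `P Q = 1`, then `M Q` is a strict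
contraction. -/
theorem norm_comp_right_inverse_lt_one {H K : Type*}
    [NormedAddCommGroup H] [NormedSpace ℂ H] [NormedAddCommGroup K] [NormedSpace ℂ K]
    (P Q : H →L[ℂ] H) (M : H →L[ℂ] K) (hPQ : ∀ y, P (Q y) = y) (c : ℝ) (hc : 0 < c)
    (hbound : ∀ x : H, c * ‖x‖ ^ 2 ≤ ‖P x‖ ^ 2 - ‖M x‖ ^ 2) :
    ‖M ∘L Q‖ < 1 := by
  set m : ℝ := ‖P‖ + 1
  have hm : 0 < m := by positivity
  have hsqrt : √(1 - c / m ^ 2) < 1 := by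
    rw [Real.sqrt_lt' one_pos]
    have : 0 < c / m ^ 2 := by positivity
    linarith
  refine lt_of_le_of_lt
    (ContinuousLinearMap.opNorm_le_bound _ (Real.sqrt_nonneg _) fun y => ?_) hsqrt
  have hy : ‖y‖ ≤ m * ‖Q y‖ := by
    have h := P.le_opNorm (Q y)
    rw [hPQ] at h
    exact h.trans (by gcongr; simp [m])
  have hy2 : c / m ^ 2 * ‖y‖ ^ 2 ≤ c * ‖Q y‖ ^ 2 := by
    calc c / m ^ 2 * ‖y‖ ^ 2 ≤ c / m ^ 2 * (m * ‖Q y‖) ^ 2 := by gcongr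
      _ = c * ‖Q y‖ ^ 2 := by field_simp
  have hb := hbound (Q y)
  rw [hPQ] at hb
  calc ‖M (Q y)‖ ≤ √((1 - c / m ^ 2) * ‖y‖ ^ 2) := Real.le_sqrt_of_sq_le (by linarith)
    _ = √(1 - c / m ^ 2) * ‖y‖ := by
      rw [Real.sqrt_mul' _ (sq_nonneg _), Real.sqrt_sq (norm_nonneg _)]

/-- If the block operator `[[A,B],[C,D]]` is a contraction and
`‖Z₊ x‖² − ‖Z₋ x‖² ≥ c ‖x‖²` with `Z₊` invertible, then `Z₊ − A Z₋` is invertible and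
`‖D + C Z₋ (Z₊ − A Z₋)⁻¹ B‖ ≤ ‖[[A,B],[C,D]]‖`. -/
theorem statement6 {H K U Y : Type}
    [NormedAddCommGroup H] [InnerProductSpace ℂ H] [CompleteSpace H]
    [NormedAddCommGroup K] [InnerProductSpace ℂ K] [CompleteSpace K]
    [NormedAddCommGroup U] [InnerProductSpace ℂ U] [CompleteSpace U]
    [NormedAddCommGroup Y] [InnerProductSpace ℂ Y] [CompleteSpace Y]
    (A : K →L[ℂ] H) (B : U →L[ℂ] H) (C : K →L[ℂ] Y) (D : U →L[ℂ] Y)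
    (hABCD : ‖blockOp A B C D‖ ≤ 1)
    (Zp : H →L[ℂ] H) (hZp : IsUnit Zp)
    (Zm : H →L[ℂ] K)
    (c : ℝ) (hc : 0 < c)
    (hbound : ∀ x : H, c * ‖x‖ ^ 2 ≤ ‖Zp x‖ ^ 2 - ‖Zm x‖ ^ 2) :
    IsUnit (Zp - A ∘L Zm) ∧
    ‖D + C ∘L Zm ∘L Ring.inverse (Zp - A ∘L Zm) ∘L B‖ ≤ ‖blockOp A B C D‖ := by
  have hunit : IsUnit (Zp - A ∘L Zm) := by
    obtain ⟨P, rfl⟩ := hZp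
    set Q : H →L[ℂ] H := ↑P⁻¹
    have hT : ‖Zm ∘L Q‖ < 1 := norm_comp_right_inverse_lt_one (P : H →L[ℂ] H) Q Zm
      (fun y => DFunLike.congr_fun P.mul_inv y) c hc hbound
    have hA : ‖A‖ ≤ 1 := (norm_le_norm_blockOp A B C D).trans hABCD
    have hAT : ‖A ∘L Zm ∘L Q‖ < 1 :=
      calc ‖A ∘L Zm ∘L Q‖ ≤ ‖A‖ * ‖Zm ∘L Q‖ := A.opNorm_comp_le _
        _ ≤ 1 * ‖Zm ∘L Q‖ := by gcongr
        _ < 1 := by rwa [one_mul]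
    have hfac : (P : H →L[ℂ] H) - A ∘L Zm = (1 - A ∘L Zm ∘L Q) * P := by
      ext x
      have hx : Q ((P : H →L[ℂ] H) x) = x := DFunLike.congr_fun P.inv_mul x
      simp [hx]
    rw [hfac]
    exact (isUnit_one_sub_of_norm_lt_one hAT).mul P.isUnit
  refine ⟨hunit, ContinuousLinearMap.opNorm_le_bound _ (ContinuousLinearMap.opNorm_nonneg _) fun u => ?_⟩
  set h : H := Ring.inverse (Zp - A ∘L Zm) (B u) with hh
  have hZ : A (Zm h) + B u = Zp h := by
    have e : (Zp - A ∘L Zm) h = B u :=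
      DFunLike.congr_fun (Ring.mul_inverse_cancel _ hunit) (B u)
    rw [← e]
    simp
  have key := blockOp_norm_sq_le A B C D (Zm h) u
  rw [hZ] at key
  have hG : (D + C ∘L Zm ∘L Ring.inverse (Zp - A ∘L Zm) ∘L B) u = C (Zm h) + D u := by
    simp [hh, add_comm]
  rw [hG]
  have hs : ‖blockOp A B C D‖ ^ 2 ≤ 1 := pow_le_one₀ (ContinuousLinearMap.opNorm_nonneg _) hABCD
  have hZm : ‖Zm h‖ ^ 2 ≤ ‖Zp h‖ ^ 2 := by
    have : 0 ≤ c * ‖h‖ ^ 2 := by positivity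
    linarith [hbound h]
  refine (sq_le_sq₀ (norm_nonneg _) (by positivity)).mp ?_
  have hle : ‖blockOp A B C D‖ ^ 2 * ‖Zm h‖ ^ 2 ≤ ‖Zp h‖ ^ 2 :=
    (mul_le_of_le_one_left (sq_nonneg _) hs).trans hZm
  rw [mul_pow]
  linarith

end
end

section
/- Let 0 < r < 1 and let k, l be positive integers. Let M be the (k+l)×(k+l) complex matrix whose only nonzero entries are M_{i, i+1} = 1 for i = 1, …, k, M_{i, i+1} = r for i = k+1, …, k+l−1, and M_{k+l, 1} = r. Then M is invertible, ‖M‖ = 1, ‖M⁻¹‖ = 1/r, and ‖M^k + M^{−l}‖ = 1 + r^{−l}, where ‖·‖ denotes the spectral norm (operator norm induced by the Euclidean norm) and M^{−l} = (M⁻¹)^l. -/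
noncomputable section

/-- Spectral norm of a complex matrix. -/
def specNorm {ι : Type} [Fintype ι] [DecidableEq ι] (M : Matrix ι ι ℂ) : ℝ :=
  ‖Matrix.toEuclideanCLM (𝕜 := ℂ) M‖

/-- The operator on the Hilbert direct sum `H^n` induced by an `n × n` matrix of operators. -/
def matOp {H : Type} [NormedAddCommGroup H] [InnerProductSpace ℂ H]
    {n : ℕ} (M : Matrix (Fin n) (Fin n) (H →L[ℂ] H)) :
    (PiLp 2 fun _ : Fin n => H) →L[ℂ] PiLp 2 fun _ : Fin n => H :=
  (((PiLp.continuousLinearEquiv 2 ℂ fun _ : Fin n => H).symm : (∀ _ : Fin n, H) →L[ℂ] _)) ∘L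
    (ContinuousLinearMap.pi fun i => ∑ j, (M i j) ∘L ContinuousLinearMap.proj (R := ℂ) j) ∘L
    (((PiLp.continuousLinearEquiv 2 ℂ fun _ : Fin n => H) : _ →L[ℂ] (∀ _ : Fin n, H)))

/-- Evaluation of a one-variable rational function at a bounded operator:
`(p/q)(T) = p(T) q(T)⁻¹`. -/
def ratOpEval {H : Type} [NormedAddCommGroup H] [NormedSpace ℂ H]
    (f : RatFunc ℂ) (T : H →L[ℂ] H) : H →L[ℂ] H :=
  Polynomial.aeval T f.num * Ring.inverse (Polynomial.aeval T f.denom)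

/-- Evaluation of a `k`-variable polynomial at a tuple of bounded operators. -/
def mvOpEval {H : Type} [NormedAddCommGroup H] [NormedSpace ℂ H] {k : ℕ}
    (p : MvPolynomial (Fin k) ℂ) (T : Fin k → H →L[ℂ] H) : H →L[ℂ] H :=
  ∑ m ∈ p.support, MvPolynomial.coeff m p • (List.ofFn fun j : Fin k => (T j) ^ (m j)).prod


/-- A continuous linear map sending a unit vector to a multiple `c` of a unit vector has norm at
least `‖c‖`. -/
theorem norm_le_opNorm_of_apply_eq_smul {E : Type*} [NormedAddCommGroup E] [NormedSpace ℂ E]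
    (T : E →L[ℂ] E) {u v : E} (hu : ‖u‖ = 1) (hv : ‖v‖ = 1) {c : ℂ} (h : T v = c • u) :
    ‖c‖ ≤ ‖T‖ := by
  have := T.le_opNorm v
  rwa [h, norm_smul, hu, hv, mul_one, mul_one] at this

/-- If `T` shifts the sequence `e` down by one step with constant weight `c` between the positions
`a` and `a + m`, then `T ^ m` sends `e (a + m)` to `c ^ m • e a`. -/
theorem pow_apply_of_shift {E : Type*} [NormedAddCommGroup E] [NormedSpace ℂ E]
    (T : E →L[ℂ] E) (e : ℕ → E) (c : ℂ) (a m : ℕ)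
    (h : ∀ i, a ≤ i → i < a + m → T (e (i + 1)) = c • e i) :
    (T ^ m) (e (a + m)) = c ^ m • e a := by
  induction m with
  | zero => simp
  | succ m ih =>
    rw [pow_succ, mul_apply_eq_comp, ← add_assoc, h (a + m) (by omega) (by omega),
      map_smul, ih fun i hi hi' => h i hi (by omega), smul_smul, pow_succ']

/-- If `S` is a two-sided inverse of `T` and `T ^ m` sends `u` to a nonzero multiple `c ^ m` of
`v`, then `S ^ m` sends `v` to `c⁻¹ ^ m • u`. -/
theorem pow_inverse_apply {E : Type*} [NormedAddCommGroup E] [NormedSpace ℂ E]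
    {S T : E →L[ℂ] E} (hST : S * T = 1) (hTS : T * S = 1) {c : ℂ} (hc : c ≠ 0) {m : ℕ} {u v : E}
    (h : (T ^ m) u = c ^ m • v) : (S ^ m) v = c⁻¹ ^ m • u := by
  have hcomm : Commute S T := hST.trans hTS.symm
  have h1 : (S ^ m) ((T ^ m) u) = u := by
    rw [← mul_apply_eq_comp, ← hcomm.mul_pow, hST, one_pow, one_apply_eq_self]
  rw [h, map_smul] at h1
  rw [← h1, smul_smul, ← mul_pow, inv_mul_cancel₀ hc, one_pow, one_smul]

/-- Norm bounds for a weighted cyclic shift whose weights lie in `[a, b]`. -/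
theorem weightedShift_norm_bounds {n : ℕ} [NeZero n] {a b : ℝ} (ha : 0 ≤ a) (hb : 0 ≤ b)
    (w : Fin n → ℂ) (haw : ∀ i, a ≤ ‖w i‖) (hwb : ∀ i, ‖w i‖ ≤ b)
    {x y : EuclideanSpace ℂ (Fin n)} (h : ∀ i, y i = w i * x (i + 1)) :
    a * ‖x‖ ≤ ‖y‖ ∧ ‖y‖ ≤ b * ‖x‖ := by
  have hx : ‖x‖ ^ 2 = ∑ i, ‖x (i + 1)‖ ^ 2 := by
    rw [EuclideanSpace.norm_sq_eq]
    exact (Equiv.sum_comp (Equiv.addRight (1 : Fin n)) fun i => ‖x i‖ ^ 2).symm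
  have hy : ‖y‖ ^ 2 = ∑ i, ‖w i‖ ^ 2 * ‖x (i + 1)‖ ^ 2 := by
    rw [EuclideanSpace.norm_sq_eq]
    simp only [h, norm_mul, mul_pow]
  constructor
  · refine le_of_pow_le_pow_left₀ two_ne_zero (norm_nonneg _) ?_
    rw [mul_pow, hx, hy, Finset.mul_sum]
    gcongr with i
    exact haw i
  · refine le_of_pow_le_pow_left₀ two_ne_zero (by positivity) ?_
    rw [mul_pow, hx, hy, Finset.mul_sum]
    gcongr with i
    exact hwb i

/-- The explicit `(k+l) × (k+l)` shift-type matrix `M` (ones on the first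
`k` superdiagonal entries, `r` on the remaining superdiagonal entries and in the lower-left
corner) is invertible with `‖M‖ = 1`, `‖M⁻¹‖ = 1/r` and `‖Mᵏ + M⁻ˡ‖ = 1 + r⁻ˡ`. -/
theorem statement14 (r : ℝ) (h0r : 0 < r) (hr1 : r < 1) (k l : ℕ) (hk : 0 < k) (hl : 0 < l)
    (M : Matrix (Fin (k + l)) (Fin (k + l)) ℂ)
    (hM : ∀ i j : Fin (k + l),
      M i j = if (j : ℕ) = (i : ℕ) + 1 then (if (i : ℕ) < k then 1 else (r : ℂ))
        else if (i : ℕ) = k + l - 1 ∧ (j : ℕ) = 0 then (r : ℂ) else 0) :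
    IsUnit M ∧ specNorm M = 1 ∧ specNorm M⁻¹ = 1 / r ∧
    specNorm (M ^ k + M⁻¹ ^ l) = 1 + (1 / r) ^ l := by
  have : NeZero (k + l) := ⟨by omega⟩
  have hr : (r : ℂ) ≠ 0 := by exact_mod_cast h0r.ne'
  let w : Fin (k + l) → ℂ := fun i => if (i : ℕ) < k then 1 else r
  have hrw (i) : r ≤ ‖w i‖ := by
    dsimp only [w]
    split_ifs <;> simp [abs_of_pos h0r, hr1.le]
  have hw1 (i) : ‖w i‖ ≤ 1 := by
    dsimp only [w]
    split_ifs <;> simp [abs_of_pos h0r, hr1.le]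
  have hMw (i j) : M i j = if j = i + 1 then w i else 0 := by
    have hj : j = i + 1 ↔ (j : ℕ) = i + 1 ∨ ((i : ℕ) = k + l - 1 ∧ (j : ℕ) = 0) := by
      have := i.isLt
      have := j.isLt
      rw [Fin.ext_iff, Fin.val_add, Fin.val_one', Nat.add_mod_mod]
      by_cases hi : (i : ℕ) + 1 < k + l
      · rw [Nat.mod_eq_of_lt hi]
        omega
      · rw [show (i : ℕ) + 1 = k + l by omega, Nat.mod_self]
        omega
    rw [hM]
    simp only [hj, w]
    split_ifs <;> first | rfl | omega
  set T := Matrix.toEuclideanCLM (𝕜 := ℂ) M with hT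
  have hTx (x) (i) : T x i = w i * x (i + 1) := by
    simp [hT, Matrix.ofLp_toEuclideanCLM, Matrix.mulVec, dotProduct, hMw]
  have hbounds (x) := weightedShift_norm_bounds h0r.le zero_le_one w hrw hw1 (hTx x)
  have hunit : IsUnit M := by
    rw [← Matrix.mulVec_injective_iff_isUnit]
    refine (injective_iff_map_eq_zero (Matrix.mulVecLin M)).2 fun v hv => ?_
    have hTv : T (WithLp.toLp 2 v) = 0 := by
      ext i
      simpa [hT, Matrix.ofLp_toEuclideanCLM] using congrFun hv i
    have hle := (hbounds (WithLp.toLp 2 v)).1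
    rw [hTv, norm_zero] at hle
    have hzero : ‖WithLp.toLp 2 v‖ = 0 :=
      le_antisymm (nonpos_of_mul_nonpos_right hle h0r) (norm_nonneg _)
    simpa using hzero
  have hdet := (Matrix.isUnit_iff_isUnit_det M).1 hunit
  set S := Matrix.toEuclideanCLM (𝕜 := ℂ) M⁻¹ with hS
  have hST : S * T = 1 := by rw [hS, hT, ← map_mul, Matrix.nonsing_inv_mul _ hdet, map_one]
  have hTS : T * S = 1 := by rw [hS, hT, ← map_mul, Matrix.mul_nonsing_inv _ hdet, map_one]
  let e : ℕ → EuclideanSpace ℂ (Fin (k + l)) := fun i =>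
    EuclideanSpace.single (Fin.ofNat (k + l) i) 1
  have hnorm (i) : ‖e i‖ = 1 := by simp [e]
  have hper : e (k + l) = e 0 := by
    have : Fin.ofNat (k + l) (k + l) = Fin.ofNat (k + l) 0 := by ext; simp
    simp only [e, this]
  have hshift (i : ℕ) (hi : i < k + l) : T (e (i + 1)) = (if i < k then 1 else (r : ℂ)) • e i := by
    have hval : ((Fin.ofNat (k + l) i : Fin (k + l)) : ℕ) = i := Nat.mod_eq_of_lt hi
    have hsucc : Fin.ofNat (k + l) (i + 1) = Fin.ofNat (k + l) i + 1 := by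
      ext
      simp [Fin.val_add]
    simp only [e, hsucc]
    have hw : w (Fin.ofNat (k + l) i) = if i < k then 1 else (r : ℂ) := by simp only [w, hval]
    rw [← hw]
    ext j
    rw [hTx]
    by_cases hj : j = Fin.ofNat (k + l) i
    · rw [hj, PiLp.smul_apply, PiLp.single_apply, PiLp.single_apply, if_pos rfl, if_pos rfl,
        smul_eq_mul]
    · rw [PiLp.smul_apply, PiLp.single_apply, PiLp.single_apply, if_neg hj,
        if_neg (hj ∘ add_right_cancel), mul_zero, smul_zero]
  have hTk : (T ^ k) (e k) = (1 : ℂ) • e 0 := by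
    have := pow_apply_of_shift T e 1 0 k fun i _ hi => by
      rw [hshift i (by omega), if_pos (by omega)]
    simpa using this
  have hSl : (S ^ l) (e k) = (r : ℂ)⁻¹ ^ l • e 0 := by
    refine pow_inverse_apply hST hTS hr ?_
    rw [← hper]
    exact pow_apply_of_shift T e r k l fun i hi hi' => by
      rw [hshift i hi', if_neg (by omega)]
  have hT1 : T (e 1) = (1 : ℂ) • e 0 := by
    rw [hshift 0 (by omega), if_pos hk]
  have hS1 : S (e k) = (r : ℂ)⁻¹ • e (k + 1) := by
    have := pow_inverse_apply (m := 1) (u := e (k + 1)) (v := e k) hST hTS hr (by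
      rw [pow_one, pow_one, hshift k (by omega), if_neg (lt_irrefl k)])
    simpa using this
  have hTle : ‖T‖ ≤ 1 := T.opNorm_le_bound zero_le_one fun x => (hbounds x).2
  have hSle : ‖S‖ ≤ 1 / r := S.opNorm_le_bound (by positivity) fun y => by
    have hle := (hbounds (S y)).1
    rw [← mul_apply_eq_comp, hTS, one_apply_eq_self] at hle
    rw [one_div, ← div_eq_inv_mul, le_div_iff₀' h0r]
    exact hle
  refine ⟨hunit, le_antisymm hTle ?_, le_antisymm hSle ?_, ?_⟩
  · simpa [specNorm] using norm_le_opNorm_of_apply_eq_smul T (hnorm 0) (hnorm 1) hT1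
  · simpa [specNorm, abs_of_pos h0r] using
      norm_le_opNorm_of_apply_eq_smul S (hnorm (k + 1)) (hnorm k) hS1
  · rw [specNorm, map_add, map_pow, map_pow, ← hT, ← hS]
    refine le_antisymm ?_ ?_
    · calc ‖T ^ k + S ^ l‖ ≤ ‖T ^ k‖ + ‖S ^ l‖ := norm_add_le _ _
        _ ≤ ‖T‖ ^ k + ‖S‖ ^ l := add_le_add (norm_pow_le' T hk) (norm_pow_le' S hl)
        _ ≤ 1 + (1 / r) ^ l := by
          gcongr
          exact pow_le_one₀ (norm_nonneg _) hTle
    · have happly : (T ^ k + S ^ l) (e k) = ((1 + (1 / r) ^ l : ℝ) : ℂ) • e 0 := by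
        rw [add_apply, hTk, hSl, ← add_smul]
        simp
      have hle := norm_le_opNorm_of_apply_eq_smul _ (hnorm 0) (hnorm k) happly
      rwa [Complex.norm_real, Real.norm_of_nonneg (by positivity)] at hle

end
end
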